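/- arXiv:1007.1555 — 2 statements merged into one kernel-verified Lean document; each statement's English description precedes it below -/
import Mathlib

section
/- Let P₀, Q₀, M, N be symmetric 2-groups and let F₀ : P₀ ⥤ M, G₀ : Q₀ ⥤ N, H : M ⥤ N, H₀ : P₀ ⥤ Q₀ be symmetric monoidal functors equipped with a monoidal natural isomorphism ε₀ : H₀ ⋙ G₀ ≅ F₀ ⋙ H. Then there is a functor H̄₀ : Ker F₀ ⥤ Ker G₀, defined on objects by H̄₀(X, a) = (H₀(X), ã), where ã is the composite isomorphism G₀(H₀(X)) ≅ H(F₀(X)) ≅ H(𝟙) ≅ 𝟙 (using (ε₀)_X, H applied to a, and the unit constraint of H), and on morphisms by f ↦ H₀(f); moreover H̄₀ ⋙ e_{G₀} = e_{F₀} ⋙ H₀, i.e. the induced square with the forgetful functors commutes. -/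
open CategoryTheory MonoidalCategory Functor.LaxMonoidal Functor.OplaxMonoidal

universe w v u

section Kernel

variable {A : Type u} {B : Type v} [Category.{w} A] [Category.{w} B] [MonoidalCategory B]

/-- The kernel of a morphism `F : A ⥤ B` of symmetric 2-groups: objects are pairs `(X, a)`
with `X` an object of `A` and `a : F(X) ≅ 𝟙` an isomorphism in `B`. -/
structure MKer (F : A ⥤ B) where
  X : A
  a : F.obj X ≅ 𝟙_ B

/-- Morphisms `(X, a) → (X', a')` in the kernel are morphisms `f : X ⟶ X'` in `A` such that
`a' ∘ F(f) = a`. -/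
instance MKer.category (F : A ⥤ B) : Category (MKer F) where
  Hom k k' := { f : k.X ⟶ k'.X // F.map f ≫ k'.a.hom = k.a.hom }
  id k := ⟨𝟙 k.X, by simp⟩
  comp f g := ⟨f.1 ≫ g.1, by rw [Functor.map_comp, Category.assoc, g.2, f.2]⟩
  id_comp f := Subtype.ext (Category.id_comp f.1)
  comp_id f := Subtype.ext (Category.comp_id f.1)
  assoc f g h := Subtype.ext (Category.assoc f.1 g.1 h.1)

/-- The forgetful functor `e_F : Ker F ⥤ A`, `(X, a) ↦ X`. -/
def MKer.forget (F : A ⥤ B) : MKer F ⥤ A where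
  obj k := k.X
  map f := f.1

end Kernel

/-- A square of functors commuting up to a natural isomorphism, whose bottom functor is
monoidal, induces a functor between the kernels of its vertical functors. -/
def MKer.map {A A' : Type u} {B B' : Type v} [Category.{w} A] [Category.{w} A']
    [Category.{w} B] [MonoidalCategory B] [Category.{w} B'] [MonoidalCategory B']
    {F : A ⥤ B} {G : A' ⥤ B'} (H : B ⥤ B') [H.Monoidal] (K : A ⥤ A')
    (e : K ⋙ G ≅ F ⋙ H) : MKer F ⥤ MKer G where
  obj k := ⟨K.obj k.X, e.app k.X ≪≫ H.mapIso k.a ≪≫ (Functor.Monoidal.εIso H).symm⟩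
  map {k k'} f := ⟨K.map f.1, by
    have naturality : G.map (K.map f.1) ≫ e.hom.app k'.X = e.hom.app k.X ≫ H.map (F.map f.1) :=
      e.hom.naturality f.1
    have compat : H.map (F.map f.1) ≫ H.map k'.a.hom = H.map k.a.hom := by
      rw [← H.map_comp, f.2]
    simp only [Iso.trans_hom, Iso.app_hom, Functor.mapIso_hom]
    rw [reassoc_of% naturality, reassoc_of% compat]⟩
  map_id k := Subtype.ext (K.map_id k.X)
  map_comp f g := Subtype.ext (K.map_comp f.1 g.1)

/-- **Statement 3.** Let `P₀, Q₀, M, N` be symmetric 2-groups and `F₀ : P₀ ⥤ M`,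
`G₀ : Q₀ ⥤ N`, `H : M ⥤ N`, `H₀ : P₀ ⥤ Q₀` symmetric monoidal functors equipped with a
monoidal natural isomorphism `ε₀ : H₀ ⋙ G₀ ≅ F₀ ⋙ H`.  Then there is a functor
`H̄₀ : Ker F₀ ⥤ Ker G₀` given on objects by `(X, a) ↦ (H₀ X, ã)`, where `ã` is the composite
`G₀(H₀ X) ≅ H(F₀ X) ≅ H(𝟙) ≅ 𝟙`, and on morphisms by `f ↦ H₀ f`; moreover
`H̄₀ ⋙ e_{G₀} = e_{F₀} ⋙ H₀`. -/
theorem kernel_induced_functor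
    (P₀ Q₀ M N : Type u)
    [Groupoid.{u} P₀] [MonoidalCategory P₀] [SymmetricCategory P₀]
    [Groupoid.{u} Q₀] [MonoidalCategory Q₀] [SymmetricCategory Q₀]
    [Groupoid.{u} M] [MonoidalCategory M] [SymmetricCategory M]
    [Groupoid.{u} N] [MonoidalCategory N] [SymmetricCategory N]
    (hP₀ : ∀ X : P₀, ∃ X', Nonempty (X ⊗ X' ≅ 𝟙_ P₀))
    (hQ₀ : ∀ X : Q₀, ∃ X', Nonempty (X ⊗ X' ≅ 𝟙_ Q₀))
    (hM : ∀ X : M, ∃ X', Nonempty (X ⊗ X' ≅ 𝟙_ M))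
    (hN : ∀ X : N, ∃ X', Nonempty (X ⊗ X' ≅ 𝟙_ N))
    (F₀ : P₀ ⥤ M) [F₀.Braided] (G₀ : Q₀ ⥤ N) [G₀.Braided]
    (H : M ⥤ N) [H.Braided] (H₀ : P₀ ⥤ Q₀) [H₀.Braided]
    (ε₀ : H₀ ⋙ G₀ ≅ F₀ ⋙ H) [NatTrans.IsMonoidal ε₀.hom] :
    ∃ Hbar : MKer F₀ ⥤ MKer G₀,
      (∀ k : MKer F₀,
        Hbar.obj k =
          ⟨H₀.obj k.X, ε₀.app k.X ≪≫ H.mapIso k.a ≪≫ (Functor.Monoidal.εIso H).symm⟩) ∧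
      (∀ (k k' : MKer F₀) (f : k ⟶ k'), HEq (Hbar.map f).1 (H₀.map f.1)) ∧
      Hbar ⋙ MKer.forget G₀ = MKer.forget F₀ ⋙ H₀ := by
  exact ⟨MKer.map H H₀ ε₀, fun _ => rfl, fun _ _ _ => HEq.rfl, rfl⟩
end

section
/- Let A, B, C, P₀, Q₀ be symmetric 2-groups and let F : A ⥤ B, G : B ⥤ C be symmetric monoidal functors equipped with a monoidal natural isomorphism φ with components φ_X : G(F(X)) ≅ 𝟙 for every object X of A. Assume: (1) G is essentially surjective; (2) for every object Y of B admitting an isomorphism G(Y) ≅ 𝟙 there exists an object X of A with F(X) ≅ Y; (3) L₀ : P₀ ⥤ A and N₀ : Q₀ ⥤ C are essentially surjective symmetric monoidal functors; and (4) N̄₀ : Q₀ ⥤ B is a symmetric monoidal functor equipped with a natural isomorphism h₀ : N̄₀ ⋙ G ≅ N₀. Then the functor M₀ : P₀ × Q₀ ⥤ B defined on objects by M₀(x, y) = F(L₀(x)) ⊗ N̄₀(y) (and on morphisms by (f, g) ↦ F(L₀(f)) ⊗ N̄₀(g)) is essentially surjective. -/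
open CategoryTheory MonoidalCategory Functor.LaxMonoidal Functor.OplaxMonoidal

/-- **Statement 4.** Let `A, B, C, P₀, Q₀` be symmetric 2-groups, `F : A ⥤ B`, `G : B ⥤ C`
symmetric monoidal functors with a (monoidal) natural isomorphism `φ` with components
`φ_X : G(F(X)) ≅ 𝟙`.  Assume (1) `G` is essentially surjective; (2) every object `Y` of `B`
with `G(Y) ≅ 𝟙` admits an object `X` of `A` with `F(X) ≅ Y`; (3) `L₀ : P₀ ⥤ A` and
`N₀ : Q₀ ⥤ C` are essentially surjective symmetric monoidal functors; (4) `N̄₀ : Q₀ ⥤ B` is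
a symmetric monoidal functor with a natural isomorphism `h₀ : N̄₀ ⋙ G ≅ N₀`.  Then the
functor `M₀ : P₀ × Q₀ ⥤ B`, `(x, y) ↦ F(L₀ x) ⊗ N̄₀ y`, `(f, g) ↦ F(L₀ f) ⊗ N̄₀ g`, is
essentially surjective. -/
theorem extension_middle_resolution_essSurj
    (A B C P₀ Q₀ : Type*)
    [Groupoid A] [MonoidalCategory A] [SymmetricCategory A]
    [Groupoid B] [MonoidalCategory B] [SymmetricCategory B]
    [Groupoid C] [MonoidalCategory C] [SymmetricCategory C]
    [Groupoid P₀] [MonoidalCategory P₀] [SymmetricCategory P₀]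
    [Groupoid Q₀] [MonoidalCategory Q₀] [SymmetricCategory Q₀]
    (hA : ∀ X : A, ∃ X', Nonempty (X ⊗ X' ≅ 𝟙_ A))
    (hB : ∀ X : B, ∃ X', Nonempty (X ⊗ X' ≅ 𝟙_ B))
    (hC : ∀ X : C, ∃ X', Nonempty (X ⊗ X' ≅ 𝟙_ C))
    (hP₀ : ∀ X : P₀, ∃ X', Nonempty (X ⊗ X' ≅ 𝟙_ P₀))
    (hQ₀ : ∀ X : Q₀, ∃ X', Nonempty (X ⊗ X' ≅ 𝟙_ Q₀))
    (F : A ⥤ B) [F.Braided] (G : B ⥤ C) [G.Braided]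
    (φ : F ⋙ G ≅ (Functor.const A).obj (𝟙_ C))
    [G.EssSurj]
    (hker : ∀ Y : B, Nonempty (G.obj Y ≅ 𝟙_ C) → ∃ X : A, Nonempty (F.obj X ≅ Y))
    (L₀ : P₀ ⥤ A) [L₀.Braided] [L₀.EssSurj]
    (N₀ : Q₀ ⥤ C) [N₀.Braided] [N₀.EssSurj]
    (Nbar₀ : Q₀ ⥤ B) [Nbar₀.Braided] (h₀ : Nbar₀ ⋙ G ≅ N₀) :
    (((L₀ ⋙ F).prod Nbar₀) ⋙ MonoidalCategory.tensor B).EssSurj := by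
  refine ⟨fun Y ↦ ?_⟩
  let y : Q₀ := N₀.objPreimage (G.obj Y)
  let i : G.obj Y ≅ G.obj (Nbar₀.obj y) :=
    (N₀.objObjPreimageIso (G.obj Y)).symm ≪≫ (h₀.app y).symm
  obtain ⟨Z, ⟨e⟩⟩ := hB (Nbar₀.obj y)
  obtain ⟨X, ⟨k⟩⟩ := hker (Y ⊗ Z)
    ⟨(Functor.Monoidal.μIso G Y Z).symm ≪≫ whiskerRightIso i (G.obj Z) ≪≫
      Functor.Monoidal.μIso G (Nbar₀.obj y) Z ≪≫ G.mapIso e ≪≫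
      (Functor.Monoidal.εIso G).symm⟩
  exact ⟨(L₀.objPreimage X, y),
    ⟨whiskerRightIso (F.mapIso (L₀.objObjPreimageIso X) ≪≫ k) (Nbar₀.obj y) ≪≫
      α_ Y Z (Nbar₀.obj y) ≪≫ whiskerLeftIso Y (β_ Z (Nbar₀.obj y) ≪≫ e) ≪≫ ρ_ Y⟩⟩
end
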